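/- For every ideal I ⊆ K[X][U] and every monomial order ≺, the Gröbner cone C_≺(I) is a convex cone: it is closed under addition and under multiplication by nonnegative real scalars. -/

import Mathlib

open MvPolynomial

/-- A monomial order on exponent vectors in `Fin N →₀ ℕ`:
a linear order compatible with addition in which `0` is the least element. -/
structure MonoOrder (N : ℕ) where
  lt : (Fin N →₀ ℕ) → (Fin N →₀ ℕ) → Prop
  total : ∀ a b, a = b ∨ lt a b ∨ lt b a
  trans : ∀ a b c, lt a b → lt b c → lt a c
  irrefl : ∀ a, ¬ lt a a
  add_right : ∀ a b c, lt a b → lt (a + c) (b + c)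
  zero_lt : ∀ a, a ≠ 0 → lt 0 a

variable {N : ℕ} {K : Type*} [Field K]

/-- The ω-degree `ω · d` of an exponent vector `d`. -/
noncomputable def wdeg (ω : Fin N → ℝ) (d : Fin N → ℕ) : ℝ :=
  ∑ i, ω i * (d i : ℝ)

/-- The ≺-maximal exponent in the support of `p` (the exponent of the leading term). -/
noncomputable def leadExp (mo : MonoOrder N) (p : MvPolynomial (Fin N) K) : Fin N →₀ ℕ :=
  open Classical in
  if h : ∃ d ∈ p.support, ∀ e ∈ p.support, e ≠ d → mo.lt e d then h.choose else 0

/-- The leading term `lt_≺(p)` of `p` w.r.t. the monomial order `mo`. -/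
noncomputable def leadTerm (mo : MonoOrder N) (p : MvPolynomial (Fin N) K) :
    MvPolynomial (Fin N) K :=
  monomial (leadExp mo p) (p.coeff (leadExp mo p))

/-- `p ∈ K[X]`: the polynomial `p` involves only the first `n` variables. -/
def inKX (n : ℕ) (p : MvPolynomial (Fin N) K) : Prop :=
  ∀ d ∈ p.support, ∀ i : Fin N, n ≤ (i : ℕ) → d i = 0

open Classical in
/-- Initial form `lt_ω(p)`: the sum of the terms of `p` of maximal ω-degree. -/
noncomputable def initForm (ω : Fin N → ℝ) (p : MvPolynomial (Fin N) K) :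
    MvPolynomial (Fin N) K :=
  ∑ d ∈ p.support.filter (fun d : Fin N →₀ ℕ => ∀ e ∈ p.support, wdeg ω ⇑e ≤ wdeg ω ⇑d),
    monomial d (p.coeff d)

/-- The initial ideal `⟨lt_ω(I)⟩` w.r.t. a weight vector ω. -/
noncomputable def ltIdealW (ω : Fin N → ℝ) (I : Ideal (MvPolynomial (Fin N) K)) :
    Ideal (MvPolynomial (Fin N) K) :=
  Ideal.span (initForm ω '' (I : Set (MvPolynomial (Fin N) K)))

/-- The initial ideal `⟨lt_≺(I)⟩` w.r.t. a monomial order. -/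
noncomputable def ltIdealO (mo : MonoOrder N) (I : Ideal (MvPolynomial (Fin N) K)) :
    Ideal (MvPolynomial (Fin N) K) :=
  Ideal.span (leadTerm mo '' (I : Set (MvPolynomial (Fin N) K)))

/-- The Gröbner cone `C_≺(I)`. -/
noncomputable def gCone (mo : MonoOrder N) (I : Ideal (MvPolynomial (Fin N) K)) :
    Set (Fin N → ℝ) :=
  closure {ω | (∀ i, 0 ≤ ω i) ∧ ltIdealW ω I = ltIdealO mo I}

/-- `G` is the normed reduced Gröbner basis of `I` w.r.t. `mo`. -/
def IsRedGB (mo : MonoOrder N) (I : Ideal (MvPolynomial (Fin N) K))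
    (G : Set (MvPolynomial (Fin N) K)) : Prop :=
  G.Finite ∧ G ⊆ (I : Set (MvPolynomial (Fin N) K)) ∧
  Ideal.span (leadTerm mo '' G) = ltIdealO mo I ∧
  (∀ g ∈ G, g ≠ 0 ∧ g.coeff (leadExp mo g) = 1) ∧
  (∀ g ∈ G, ∀ h ∈ G, g ≠ h → ∀ d ∈ h.support, ¬ leadExp mo g ≤ d)

/-- `mo` is an `I`-specific elimination order for the last variables:
every element of the reduced Gröbner basis whose leading term lies in `K[X]`
lies itself in `K[X]`. -/
def IsEO (n : ℕ) (mo : MonoOrder N) (I : Ideal (MvPolynomial (Fin N) K)) : Prop :=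
  ∀ G : Set (MvPolynomial (Fin N) K), IsRedGB mo I G →
    ∀ g ∈ G, inKX n (leadTerm mo g) → inKX n g

/-- `ω` is an `I`-specific elimination vector. -/
def IsEV (n : ℕ) (I : Ideal (MvPolynomial (Fin N) K)) (ω : Fin N → ℝ) : Prop :=
  (∀ i, 0 ≤ ω i) ∧ ∃ mo : MonoOrder N, IsEO n mo I ∧ ω ∈ gCone mo I

/-- The monomial order `mo` refines the weight vector `ω`. -/
def Refines (mo : MonoOrder N) (ω : Fin N → ℝ) : Prop :=
  ∀ d e : Fin N →₀ ℕ, wdeg ω ⇑d < wdeg ω ⇑e → mo.lt d e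

/-- `Ω_u`: the set of weight vectors vanishing on the first `n` coordinates. -/
def OmegaU (n N : ℕ) : Set (Fin N → ℝ) :=
  {ω | (∀ i, 0 ≤ ω i) ∧ ∀ i : Fin N, (i : ℕ) < n → ω i = 0}

/-- `L_{X,≺}(G)`: the elements of `G` whose leading term lies in `K[X]`. -/
def LXset (n : ℕ) (mo : MonoOrder N) (G : Set (MvPolynomial (Fin N) K)) :
    Set (MvPolynomial (Fin N) K) :=
  {p ∈ G | inKX n (leadTerm mo p)}
lemma castAdd_inj (n m : ℕ) : Function.Injective (Fin.castAdd m : Fin n → Fin (n + m)) := by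
  intro a b h
  exact Fin.ext (by simpa using congrArg Fin.val h)

/-- Extend an exponent vector on the first `n` variables to all `n + m` variables. -/
noncomputable def extExp (n m : ℕ) (a : Fin n →₀ ℕ) : Fin (n + m) →₀ ℕ :=
  Finsupp.mapDomain (Fin.castAdd m) a

/-- The restriction of a monomial order on `K[X][U]` to the monomials of `K[X]`. -/
noncomputable def restrictOrder (n m : ℕ) (mo : MonoOrder (n + m)) : MonoOrder n where
  lt a b := mo.lt (extExp n m a) (extExp n m b)
  total a b := by
    rcases mo.total (extExp n m a) (extExp n m b) with h | h | h
    · exact Or.inl (Finsupp.mapDomain_injective (castAdd_inj n m) h)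
    · exact Or.inr (Or.inl h)
    · exact Or.inr (Or.inr h)
  trans a b c hab hbc := mo.trans _ _ _ hab hbc
  irrefl a := mo.irrefl _
  add_right a b c h := by
    show mo.lt (extExp n m (a + c)) (extExp n m (b + c))
    rw [show extExp n m (a + c) = extExp n m a + extExp n m c from Finsupp.mapDomain_add,
        show extExp n m (b + c) = extExp n m b + extExp n m c from Finsupp.mapDomain_add]
    exact mo.add_right _ _ _ h
  zero_lt a ha := by
    show mo.lt (extExp n m 0) (extExp n m a)
    have h0 : extExp n m (0 : Fin n →₀ ℕ) = 0 := Finsupp.mapDomain_zero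
    rw [h0]
    refine mo.zero_lt _ (fun h => ha ?_)
    exact Finsupp.mapDomain_injective (castAdd_inj n m) (h.trans h0.symm)

/-- The projection `K[X][U] → K[X]` sending each `u`-variable to `0`;
on polynomials of `K[X]` it inverts the canonical inclusion `K[X] → K[X][U]`. -/
noncomputable def projX (n m : ℕ) (K : Type*) [Field K] :
    MvPolynomial (Fin (n + m)) K →ₐ[K] MvPolynomial (Fin n) K :=
  aeval (fun i : Fin (n + m) => if h : (i : ℕ) < n then X ⟨(i : ℕ), h⟩ else 0)

/-- The elimination ideal `I ∩ K[X]`, viewed as an ideal of `K[x_1,…,x_n]` via the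
canonical inclusion `K[X] → K[X][U]`. -/
noncomputable def elimIdeal (n m : ℕ) {K : Type*} [Field K]
    (I : Ideal (MvPolynomial (Fin (n + m)) K)) : Ideal (MvPolynomial (Fin n) K) :=
  Ideal.comap
    (rename (Fin.castAdd m) : MvPolynomial (Fin n) K →ₐ[K] MvPolynomial (Fin (n + m)) K) I

/-- Priority of the variables for the lex order `u_1 ≻ … ≻ u_m ≻ x_1 ≻ … ≻ x_n`
(smaller priority value = more significant variable). -/
def uPrio (n m : ℕ) (i : Fin (n + m)) : ℕ :=
  if (i : ℕ) < n then m + (i : ℕ) else (i : ℕ) - n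

/-- The pure lexicographic order with `u_1 ≻ … ≻ u_m ≻ x_1 ≻ … ≻ x_n`:
`a <_lex b` iff at the most significant position where they differ, `a` is smaller. -/
def uLexLt (n m : ℕ) (a b : Fin (n + m) →₀ ℕ) : Prop :=
  ∃ i : Fin (n + m), a i < b i ∧ ∀ j : Fin (n + m), uPrio n m j < uPrio n m i → a j = b j

namespace MonoOrder

lemma not_lt_of_le (mo : MonoOrder N) {a b : Fin N →₀ ℕ} (hab : a ≤ b) : ¬ mo.lt b a := by
  intro h
  obtain ⟨c, rfl⟩ := exists_add_of_le hab
  by_cases hc : c = 0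
  · subst hc
    exact mo.irrefl a (by simpa using h)
  · have h' := mo.add_right _ _ a (mo.zero_lt c hc)
    rw [zero_add, add_comm c a] at h'
    exact mo.irrefl _ (mo.trans _ _ _ h h')

lemma wellFounded_lt (mo : MonoOrder N) : WellFounded mo.lt := by
  have : IsStrictOrder _ mo.lt := { irrefl := mo.irrefl, trans := mo.trans }
  rw [RelEmbedding.wellFounded_iff_isEmpty]
  refine ⟨fun f => ?_⟩
  obtain ⟨i, j, hij, hle⟩ := wellQuasiOrdered_le (fun k => f k)
  exact mo.not_lt_of_le hle (f.map_rel_iff.2 hij)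

lemma exists_max (mo : MonoOrder N) (s : Finset (Fin N →₀ ℕ)) (hs : s.Nonempty) :
    ∃ d ∈ s, ∀ e ∈ s, e ≠ d → mo.lt e d := by
  classical
  induction hs using Finset.Nonempty.cons_induction with
  | singleton a => exact ⟨a, by simp, by simp⟩
  | cons a s ha hs ih =>
    obtain ⟨d, hd, hmax⟩ := ih
    rcases mo.total a d with rfl | h | h
    · exact absurd hd ha
    · refine ⟨d, by simp [hd], fun e he hne => ?_⟩
      rcases Finset.mem_cons.1 he with rfl | he
      · exact h
      · exact hmax e he hne
    · refine ⟨a, by simp, fun e he hne => ?_⟩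
      rcases Finset.mem_cons.1 he with rfl | he
      · exact absurd rfl hne
      · by_cases hed : e = d
        · exact hed ▸ h
        · exact mo.trans _ _ _ (hmax e he hed) h

end MonoOrder

lemma leadExp_spec (mo : MonoOrder N) {p : MvPolynomial (Fin N) K} (hp : p ≠ 0) :
    leadExp mo p ∈ p.support ∧ ∀ e ∈ p.support, e ≠ leadExp mo p → mo.lt e (leadExp mo p) := by
  have h := mo.exists_max p.support (by simpa using hp)
  rw [leadExp, dif_pos h]
  exact h.choose_spec

/-- The exponents of the monomials of the initial ideal of `I`. -/
def initExps (mo : MonoOrder N) (I : Ideal (MvPolynomial (Fin N) K)) : Set (Fin N →₀ ℕ) :=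
  {d | ∃ f ∈ I, f ≠ 0 ∧ leadExp mo f ≤ d}

lemma mem_ltIdealO_iff (mo : MonoOrder N) (I : Ideal (MvPolynomial (Fin N) K))
    (p : MvPolynomial (Fin N) K) :
    p ∈ ltIdealO mo I ↔ ∀ d ∈ p.support, d ∈ initExps mo I := by
  have key : ltIdealO mo I = Ideal.span ((fun s => monomial s (1 : K)) ''
      {d | ∃ f ∈ I, f ≠ 0 ∧ leadExp mo f = d}) := by
    apply le_antisymm
    · refine Ideal.span_le.2 ?_
      rintro _ ⟨f, hf, rfl⟩
      by_cases h0 : f = 0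
      · subst h0
        simp [leadTerm]
      · have hmem : monomial (leadExp mo f) (1 : K) ∈ Ideal.span
            ((fun s => monomial s (1 : K)) '' {d | ∃ f ∈ I, f ≠ 0 ∧ leadExp mo f = d}) :=
          Ideal.subset_span ⟨_, ⟨f, hf, h0, rfl⟩, rfl⟩
        have := Ideal.mul_mem_left _ (C (f.coeff (leadExp mo f))) hmem
        rwa [C_mul_monomial, mul_one] at this
    · refine Ideal.span_le.2 ?_
      rintro _ ⟨_, ⟨f, hf, h0, rfl⟩, rfl⟩
      have hmem : leadTerm mo f ∈ ltIdealO mo I := Ideal.subset_span ⟨f, hf, rfl⟩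
      have := Ideal.mul_mem_left _ (C (f.coeff (leadExp mo f))⁻¹) hmem
      rwa [leadTerm, C_mul_monomial,
        inv_mul_cancel₀ (mem_support_iff.1 (leadExp_spec mo h0).1)] at this
  rw [key, mem_ideal_span_monomial_image]
  simp [initExps, and_assoc]

lemma eq_zero_of_support_disjoint (mo : MonoOrder N) {I : Ideal (MvPolynomial (Fin N) K)}
    {f : MvPolynomial (Fin N) K} (hf : f ∈ I) (h : ∀ d ∈ f.support, d ∉ initExps mo I) :
    f = 0 := by
  by_contra h0
  exact h _ (leadExp_spec mo h0).1 ⟨f, hf, h0, le_rfl⟩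

lemma exists_mem_lead (mo : MonoOrder N) {I : Ideal (MvPolynomial (Fin N) K)}
    {d : Fin N →₀ ℕ} (hd : d ∈ initExps mo I) :
    ∃ h ∈ I, coeff d h = 1 ∧ ∀ e ∈ h.support, e ≠ d → mo.lt e d := by
  obtain ⟨f, hf, h0, hle⟩ := hd
  obtain ⟨c, rfl⟩ := exists_add_of_le hle
  obtain ⟨hmem, hmax⟩ := leadExp_spec mo h0
  refine ⟨monomial c (f.coeff (leadExp mo f))⁻¹ * f, Ideal.mul_mem_left _ _ hf, ?_, ?_⟩
  · rw [add_comm, coeff_monomial_mul, inv_mul_cancel₀ (mem_support_iff.1 hmem)]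
  · intro e he hne
    rw [mem_support_iff, coeff_monomial_mul'] at he
    split_ifs at he with hce
    · obtain ⟨b, rfl⟩ := exists_add_of_le hce
      rw [add_tsub_cancel_left] at he
      have hb : b ∈ f.support := mem_support_iff.2 (right_ne_zero_of_mul he)
      have := mo.add_right _ _ c (hmax b hb (fun hb' => hne (by rw [hb', add_comm])))
      rwa [add_comm b c] at this
    · exact absurd rfl he

lemma exists_normalForm_of_support {T : Set (Fin N →₀ ℕ)} {I : Ideal (MvPolynomial (Fin N) K)}
    (p : MvPolynomial (Fin N) K)
    (h : ∀ e ∈ p.support, ∃ r : MvPolynomial (Fin N) K,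
      (∀ d ∈ T, coeff d r = 0) ∧ monomial e (1 : K) - r ∈ I) :
    ∃ r : MvPolynomial (Fin N) K, (∀ d ∈ T, coeff d r = 0) ∧ p - r ∈ I := by
  choose! r hr hrI using h
  refine ⟨∑ e ∈ p.support, C (p.coeff e) * r e, fun d hd => ?_, ?_⟩
  · rw [coeff_sum]
    exact Finset.sum_eq_zero fun e he => by rw [coeff_C_mul, hr e he d hd, mul_zero]
  · have hp : p - ∑ e ∈ p.support, C (p.coeff e) * r e =
        ∑ e ∈ p.support, (monomial e (p.coeff e) - C (p.coeff e) * r e) := by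
      rw [Finset.sum_sub_distrib, support_sum_monomial_coeff]
    rw [hp]
    refine Ideal.sum_mem _ fun e he => ?_
    have := I.mul_mem_left (C (p.coeff e)) (hrI e he)
    rwa [mul_sub, C_mul_monomial, mul_one] at this

lemma exists_normalForm_monomial (mo : MonoOrder N) (I : Ideal (MvPolynomial (Fin N) K))
    (d : Fin N →₀ ℕ) :
    ∃ r : MvPolynomial (Fin N) K,
      (∀ e ∈ initExps mo I, coeff e r = 0) ∧ monomial d (1 : K) - r ∈ I := by
  classical
  induction d using mo.wellFounded_lt.induction with
  | _ d ih =>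
    by_cases hd : d ∈ initExps mo I
    · obtain ⟨h, hI, hc, hlt⟩ := exists_mem_lead mo hd
      obtain ⟨r, hr, hrI⟩ := exists_normalForm_of_support (I := I) (T := initExps mo I)
        (monomial d 1 - h) (fun e he => ih e (by
          rw [mem_support_iff, coeff_sub, coeff_monomial] at he
          by_cases hed : d = e
          · subst hed
            simp [hc] at he
          · rw [if_neg hed, zero_sub, neg_ne_zero] at he
            exact hlt e (mem_support_iff.2 he) (Ne.symm hed)))
      refine ⟨r, hr, ?_⟩
      have := I.add_mem hrI hI
      rwa [show monomial d (1 : K) - h - r + h = monomial d 1 - r by ring] at this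
    · refine ⟨monomial d 1, fun e he => ?_, by simp⟩
      rw [coeff_monomial, if_neg]
      rintro rfl
      exact hd he

lemma exists_reduced_mem (mo : MonoOrder N) (I : Ideal (MvPolynomial (Fin N) K))
    (d : Fin N →₀ ℕ) :
    ∃ g ∈ I, ∀ e ∈ initExps mo I, coeff e g = coeff e (monomial d (1 : K)) := by
  obtain ⟨r, hr, hrI⟩ := exists_normalForm_monomial mo I d
  exact ⟨_, hrI, fun e he => by rw [coeff_sub, hr e he, sub_zero]⟩

lemma coeff_initForm (ω : Fin N → ℝ) (p : MvPolynomial (Fin N) K) (d : Fin N →₀ ℕ)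
    (h : ∀ e ∈ p.support, wdeg ω ⇑e ≤ wdeg ω ⇑d) :
    coeff d (initForm ω p) = coeff d p := by
  classical
  simp only [initForm, coeff_sum, coeff_monomial, Finset.sum_ite_eq', Finset.mem_filter]
  by_cases hd : d ∈ p.support
  · rw [if_pos ⟨hd, h⟩]
  · rw [if_neg (fun h' => hd h'.1), notMem_support_iff.1 hd]

lemma coeff_initForm_eq_zero (ω : Fin N → ℝ) (p : MvPolynomial (Fin N) K) (d : Fin N →₀ ℕ)
    (h : ¬ ∀ e ∈ p.support, wdeg ω ⇑e ≤ wdeg ω ⇑d) :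
    coeff d (initForm ω p) = 0 := by
  classical
  simp only [initForm, coeff_sum, coeff_monomial, Finset.sum_ite_eq', Finset.mem_filter]
  rw [if_neg (fun h' => h h'.2)]

/-- The initial ideals of `ω` and `≺` agree iff `ω` strictly selects the leading monomial of
every element of `I` with at most one monomial `d` that could lie in the initial ideal. -/
lemma ltIdealW_eq_ltIdealO_iff (mo : MonoOrder N) (I : Ideal (MvPolynomial (Fin N) K))
    (ω : Fin N → ℝ) :
    ltIdealW ω I = ltIdealO mo I ↔
      ∀ g ∈ I, ∀ d, (∀ e ∈ g.support, e ≠ d → e ∉ initExps mo I) →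
        ∀ e ∈ g.support, e ≠ d → wdeg ω ⇑e < wdeg ω ⇑d := by
  classical
  constructor
  · intro h g hg d hstd e he hne
    have hin : initForm ω g ∈ ltIdealO mo I := h ▸ Ideal.subset_span ⟨g, hg, rfl⟩
    rw [mem_ltIdealO_iff] at hin
    have hmax : ∀ a ∈ g.support, (∀ b ∈ g.support, wdeg ω ⇑b ≤ wdeg ω ⇑a) → a = d := by
      intro a ha hab
      by_contra had
      refine hstd a ha had (hin a ?_)
      rw [mem_support_iff, coeff_initForm ω g a hab]
      exact mem_support_iff.1 ha
    obtain ⟨a, ha, hab⟩ := g.support.exists_max_image (fun b => wdeg ω ⇑b) ⟨e, he⟩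
    obtain rfl := hmax a ha hab
    refine lt_of_le_of_ne (hab e he) fun heq => hne (hmax e he fun b hb => ?_)
    exact (hab b hb).trans heq.ge
  · intro h
    have hred : ∀ d ∈ initExps mo I, ∃ g ∈ I,
        (∀ e ∈ initExps mo I, coeff e g = coeff e (monomial d (1 : K))) ∧
        ∀ e ∈ g.support, e ≠ d → wdeg ω ⇑e < wdeg ω ⇑d := by
      intro d hd
      obtain ⟨g, hg, hc⟩ := exists_reduced_mem mo I d
      refine ⟨g, hg, hc, h g hg d fun e he hne heT => mem_support_iff.1 he ?_⟩
      rw [hc e heT, coeff_monomial, if_neg hne.symm]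
    apply le_antisymm
    · refine Ideal.span_le.2 ?_
      rintro _ ⟨f, hf, rfl⟩
      refine (mem_ltIdealO_iff mo I _).2 fun d hd => ?_
      have hmax : ∀ e ∈ f.support, wdeg ω ⇑e ≤ wdeg ω ⇑d := by
        by_contra hcon
        exact mem_support_iff.1 hd (coeff_initForm_eq_zero ω f d hcon)
      rw [mem_support_iff, coeff_initForm ω f d hmax] at hd
      by_contra hdT
      choose! g hg hc hlt using hred
      have hsum : f - ∑ a ∈ f.support with a ∈ initExps mo I, C (f.coeff a) * g a = 0 := by
        refine eq_zero_of_support_disjoint mo (I := I) (I.sub_mem hf (I.sum_mem fun a ha =>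
          I.mul_mem_left _ (hg a (Finset.mem_filter.1 ha).2))) fun e he heT => ?_
        refine mem_support_iff.1 he ?_
        rw [coeff_sub, coeff_sum, Finset.sum_congr rfl (g := fun a => if a = e then f.coeff a else 0)
          (fun a ha => by
            rw [coeff_C_mul, hc a (Finset.mem_filter.1 ha).2 e heT, coeff_monomial, mul_ite,
              mul_one, mul_zero]), Finset.sum_ite_eq']
        by_cases hef : e ∈ f.support
        · rw [if_pos (Finset.mem_filter.2 ⟨hef, heT⟩), sub_self]
        · rw [if_neg (fun h' => hef (Finset.mem_filter.1 h').1), sub_zero,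
            notMem_support_iff.1 hef]
      rw [sub_eq_zero.1 hsum, coeff_sum] at hd
      obtain ⟨a, ha, hne⟩ := Finset.exists_ne_zero_of_sum_ne_zero hd
      rw [coeff_C_mul] at hne
      obtain ⟨haf, haT⟩ := Finset.mem_filter.1 ha
      have := hlt a haT d (mem_support_iff.2 (right_ne_zero_of_mul hne))
        (fun hda => hdT (hda ▸ haT))
      exact absurd (hmax a haf) (not_le.2 this)
    · refine Ideal.span_le.2 ?_
      rintro _ ⟨f, hf, rfl⟩
      by_cases h0 : f = 0
      · subst h0
        simp [leadTerm]
      · have hd : leadExp mo f ∈ initExps mo I := ⟨f, hf, h0, le_rfl⟩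
        obtain ⟨g, hg, hc, hlt⟩ := hred _ hd
        have hle : ∀ e ∈ g.support, wdeg ω ⇑e ≤ wdeg ω ⇑(leadExp mo f) := fun e he => by
          by_cases hed : e = leadExp mo f
          · rw [hed]
          · exact (hlt e he hed).le
        have hgd : coeff (leadExp mo f) g = 1 := by rw [hc _ hd, coeff_monomial, if_pos rfl]
        have hinit : initForm ω g = monomial (leadExp mo f) 1 := by
          ext e
          rw [coeff_monomial]
          split_ifs with hed
          · rw [← hed, coeff_initForm ω g _ hle, hgd]
          · by_cases he : e ∈ g.support
            · exact coeff_initForm_eq_zero ω g e fun hcon => (hlt e he (Ne.symm hed)).not_ge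
                (hcon _ (mem_support_iff.2 (by rw [hgd]; exact one_ne_zero)))
            · by_cases hcon : ∀ b ∈ g.support, wdeg ω ⇑b ≤ wdeg ω ⇑e
              · rw [coeff_initForm ω g e hcon, notMem_support_iff.1 he]
              · exact coeff_initForm_eq_zero ω g e hcon
        have hmem : initForm ω g ∈ ltIdealW ω I := Ideal.subset_span ⟨g, hg, rfl⟩
        have := Ideal.mul_mem_left _ (C (f.coeff (leadExp mo f))) hmem
        rwa [hinit, C_mul_monomial, mul_one] at this

lemma wdeg_add (ω τ : Fin N → ℝ) (d : Fin N → ℕ) : wdeg (ω + τ) d = wdeg ω d + wdeg τ d := by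
  simp [wdeg, add_mul, Finset.sum_add_distrib]

lemma wdeg_smul (c : ℝ) (ω : Fin N → ℝ) (d : Fin N → ℕ) : wdeg (c • ω) d = c * wdeg ω d := by
  simp [wdeg, Finset.mul_sum, mul_assoc]

lemma smul_mem_gCone_of_pos (mo : MonoOrder N) (I : Ideal (MvPolynomial (Fin N) K))
    {a : Fin N → ℝ} (ha : a ∈ gCone mo I) {c : ℝ} (hc : 0 < c) : c • a ∈ gCone mo I := by
  refine map_mem_closure (continuous_const_smul c) ha ?_
  rintro ω ⟨hω, hI⟩
  refine ⟨fun i => mul_nonneg hc.le (hω i), ?_⟩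
  rw [ltIdealW_eq_ltIdealO_iff] at hI ⊢
  intro g hg d hd e he hne
  rw [wdeg_smul, wdeg_smul]
  exact mul_lt_mul_of_pos_left (hI g hg d hd e he hne) hc

/-- Every Gröbner cone `C_≺(I)` is a convex cone: it is closed under
addition and under multiplication by nonnegative real scalars. -/
theorem gCone_convexCone (n m : ℕ) {K : Type*} [Field K]
    (I : Ideal (MvPolynomial (Fin (n + m)) K)) (mo : MonoOrder (n + m)) :
    (∀ a ∈ gCone mo I, ∀ b ∈ gCone mo I, a + b ∈ gCone mo I) ∧
    (∀ a ∈ gCone mo I, ∀ c : ℝ, 0 ≤ c → c • a ∈ gCone mo I) := by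
  refine ⟨fun a ha b hb => ?_, fun a ha c hc => ?_⟩
  · refine map_mem_closure₂ continuous_add ha hb ?_
    rintro ω ⟨hω, hωI⟩ τ ⟨hτ, hτI⟩
    refine ⟨fun i => add_nonneg (hω i) (hτ i), ?_⟩
    rw [ltIdealW_eq_ltIdealO_iff] at hωI hτI ⊢
    intro g hg d hd e he hne
    rw [wdeg_add, wdeg_add]
    exact add_lt_add (hωI g hg d hd e he hne) (hτI g hg d hd e he hne)
  · have hc' : c ∈ closure (Set.Ioi (0 : ℝ)) := by
      rw [closure_Ioi]
      exact hc
    have := map_mem_closure (f := fun t : ℝ => t • a) (t := gCone mo I) (by fun_prop) hc'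
      (fun t ht => smul_mem_gCone_of_pos mo I ha ht)
    rwa [gCone, closure_closure] at this
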